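/- (Correctness of the edge-deletion algorithm.) Fix j ∈ {1,…,n} and disjoint sets N_1, N_2 ⊆ {1,…,j−1}. Define B̄ and Ω̄ from B and Ω as follows: start with B̄ = B and Ω̄ = Ω; for each k ∈ N_1, set B̄_{r,s} := 0 whenever r > k and s < k, and Ω̄_{r,i} := 0 whenever r > k; for each k ∈ N_2, set B̄_{k,s} := 0 for all s < k, and Ω̄_{k,i} := 0. Then ξ·((I−B̄)^{-1}Ω̄)_{j,i} = Q_ξ(P), where P is the set of paths from ε_i to x_j (with weights computed from the original B and Ω) that pass through x_k for every k ∈ N_1 and pass through no x_k with k ∈ N_2. -/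

import Mathlib

open Matrix Finset

namespace TCA

variable {n m : ℕ}

/-- Weight of the tail of a path after a given previous index:
for `prev` and `[k₁, …, k_t]` this is `B k₁ prev * B k₂ k₁ * ⋯ * B k_t k_{t-1}`. -/
def tailWeight (B : Matrix (Fin n) (Fin n) ℝ) : Fin n → List (Fin n) → ℝ
  | _, [] => 1
  | prev, k :: rest => B k prev * tailWeight B k rest

/-- Weight of a shock-to-variable path `[k₀, …, k_t]` for shock `i`:
`Ω k₀ i * B k₁ k₀ * ⋯ * B k_t k_{t−1}`. -/
def shockListWeight (B : Matrix (Fin n) (Fin n) ℝ) (Ω : Matrix (Fin n) (Fin m) ℝ)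
    (i : Fin m) : List (Fin n) → ℝ
  | [] => 0
  | k :: rest => Ω k i * tailWeight B k rest

/-- Weight of a variable-to-variable path `[k₀, …, k_t]`:
`B k₁ k₀ * ⋯ * B k_t k_{t−1}` (equal to `1` for a single-element path). -/
def varListWeight (B : Matrix (Fin n) (Fin n) ℝ) : List (Fin n) → ℝ
  | [] => 0
  | k :: rest => tailWeight B k rest

/-- A path from the shock to `x_j`, identified with its (nonempty) set of indices:
a strictly increasing sequence ending at `j` is exactly a finite set containing `j`
with all elements `≤ j`. -/
def PathTo (j : Fin n) (S : Finset (Fin n)) : Prop := j ∈ S ∧ ∀ k ∈ S, k ≤ j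

/-- A path from `x_r` to `x_s`, identified with its set of indices: a strictly
increasing sequence starting at `r` and ending at `s`. -/
def PathBetween (r s : Fin n) (S : Finset (Fin n)) : Prop :=
  r ∈ S ∧ s ∈ S ∧ ∀ k ∈ S, r ≤ k ∧ k ≤ s

instance (j : Fin n) : DecidablePred (PathTo j) := fun _ => by
  unfold PathTo; infer_instance

instance (r s : Fin n) : DecidablePred (PathBetween r s) := fun _ => by
  unfold PathBetween; infer_instance

/-- The set `P_{ε_i, x_j}` of all paths from the shock to `x_j`. -/
def allPathsTo (j : Fin n) : Finset (Finset (Fin n)) :=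
  Finset.univ.filter (PathTo j)

/-- The set `P_{x_r, x_s}` of all paths from `x_r` to `x_s`. -/
def allPathsBetween (r s : Fin n) : Finset (Finset (Fin n)) :=
  Finset.univ.filter (PathBetween r s)

/-- Weight of a shock-to-variable path given as a set of indices (the weight of its
strictly increasing enumeration). -/
def wShock (B : Matrix (Fin n) (Fin n) ℝ) (Ω : Matrix (Fin n) (Fin m) ℝ)
    (i : Fin m) (S : Finset (Fin n)) : ℝ :=
  shockListWeight B Ω i (S.sort (· ≤ ·))

/-- Weight of a variable-to-variable path given as a set of indices. -/
def wVar (B : Matrix (Fin n) (Fin n) ℝ) (S : Finset (Fin n)) : ℝ :=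
  varListWeight B (S.sort (· ≤ ·))

/-- Total path-specific effect `Q_ξ(P) = ξ · Σ_{p ∈ P} weight(p)`. -/
def Q (ξ : ℝ) (w : Finset (Fin n) → ℝ) (P : Finset (Finset (Fin n))) : ℝ :=
  ξ * ∑ p ∈ P, w p


/-- Appending an element larger than all others to a finite set appends it to the sorted list. -/
theorem sort_insert_of_forall_lt {T : Finset (Fin n)} {j : Fin n} (h : ∀ k ∈ T, k < j) :
    (insert j T).sort (· ≤ ·) = T.sort (· ≤ ·) ++ [j] := by
  have hj : j ∉ T := fun hj => lt_irrefl j (h j hj)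
  have hnodup : (T.sort (· ≤ ·) ++ [j]).Nodup := by
    simpa [List.nodup_append] using fun a ha => (h a ha).ne
  have hsorted : (T.sort (· ≤ ·) ++ [j]).Pairwise (· ≤ ·) := by
    simpa [List.pairwise_append] using fun a ha => (h a ha).le
  rw [← (List.toFinset_sort (· ≤ ·) hnodup).2 hsorted]
  congr 1
  ext a
  simp

theorem tailWeight_append_pair (B : Matrix (Fin n) (Fin n) ℝ) (l : List (Fin n))
    (p k j : Fin n) :
    tailWeight B p (l ++ [k, j]) = B j k * tailWeight B p (l ++ [k]) := by
  induction l generalizing p with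
  | nil => simp [tailWeight, mul_comm]
  | cons a l ih => simp only [List.cons_append, tailWeight, ih]; ring

theorem shockListWeight_append_pair (B : Matrix (Fin n) (Fin n) ℝ)
    (Ω : Matrix (Fin n) (Fin m) ℝ) (i : Fin m) (l : List (Fin n)) (k j : Fin n) :
    shockListWeight B Ω i (l ++ [k, j]) = B j k * shockListWeight B Ω i (l ++ [k]) := by
  cases l with
  | nil => simp [shockListWeight, tailWeight, mul_comm]
  | cons a l =>
    simp only [List.cons_append, shockListWeight, tailWeight_append_pair]
    ring

theorem wShock_singleton (B : Matrix (Fin n) (Fin n) ℝ) (Ω : Matrix (Fin n) (Fin m) ℝ)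
    (i : Fin m) (j : Fin n) : wShock B Ω i {j} = Ω j i := by
  simp [wShock, shockListWeight, tailWeight]

theorem wShock_insert (B : Matrix (Fin n) (Fin n) ℝ) (Ω : Matrix (Fin n) (Fin m) ℝ)
    (i : Fin m) {j k : Fin n} {S : Finset (Fin n)} (hS : PathTo k S) (hkj : k < j) :
    wShock B Ω i (insert j S) = B j k * wShock B Ω i S := by
  have hsort : S.sort (· ≤ ·) = (S.erase k).sort (· ≤ ·) ++ [k] := by
    conv_lhs => rw [← Finset.insert_erase hS.1]
    exact sort_insert_of_forall_lt fun a ha =>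
      lt_of_le_of_ne (hS.2 a (Finset.mem_of_mem_erase ha)) (Finset.ne_of_mem_erase ha)
  rw [wShock, wShock, sort_insert_of_forall_lt fun a ha => (hS.2 a ha).trans_lt hkj, hsort,
    List.append_assoc, List.singleton_append, shockListWeight_append_pair]

/-- A path to `x_j` is trivial or extends a path to some earlier variable by the edge to `x_j`. -/
theorem PathTo.eq_singleton_or_insert {j : Fin n} {S : Finset (Fin n)} (hS : PathTo j S) :
    S = {j} ∨ ∃ k < j, ∃ T, PathTo k T ∧ S = insert j T := by
  rcases (S.erase j).eq_empty_or_nonempty with h | h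
  · left
    rw [← Finset.insert_erase hS.1, h, insert_empty_eq]
  · right
    have hmem := (S.erase j).max'_mem h
    exact ⟨(S.erase j).max' h, lt_of_le_of_ne (hS.2 _ (Finset.mem_of_mem_erase hmem))
      (Finset.ne_of_mem_erase hmem), S.erase j, ⟨hmem, fun a ha => Finset.le_max' _ a ha⟩,
      (Finset.insert_erase hS.1).symm⟩

theorem PathTo.notMem_of_lt {j k : Fin n} {S : Finset (Fin n)} (hS : PathTo k S) (hkj : k < j) :
    j ∉ S := fun h => (hS.2 j h).not_gt hkj

theorem allPathsTo_eq (j : Fin n) :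
    allPathsTo j = insert {j} ((Finset.Iio j).biUnion fun k => (allPathsTo k).image (insert j)) := by
  ext S
  simp only [allPathsTo, Finset.mem_insert, Finset.mem_biUnion, Finset.mem_Iio, Finset.mem_image,
    Finset.mem_filter, Finset.mem_univ, true_and]
  constructor
  · intro hS
    rcases hS.eq_singleton_or_insert with h | ⟨k, hk, T, hT, rfl⟩
    · exact Or.inl h
    · exact Or.inr ⟨k, hk, T, hT, rfl⟩
  · rintro (rfl | ⟨k, hk, T, hT, rfl⟩)
    · simp [PathTo]
    · exact ⟨Finset.mem_insert_self _ _, fun a ha => (Finset.mem_insert.1 ha).elim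
        (fun h => h.le) fun h => (hT.2 a h).trans hk.le⟩

theorem sum_wShock_allPathsTo (B : Matrix (Fin n) (Fin n) ℝ) (Ω : Matrix (Fin n) (Fin m) ℝ)
    (i : Fin m) (j : Fin n) :
    ∑ S ∈ allPathsTo j, wShock B Ω i S
      = Ω j i + ∑ k ∈ Finset.Iio j, B j k * ∑ S ∈ allPathsTo k, wShock B Ω i S := by
  have mem {k : Fin n} {S : Finset (Fin n)} : S ∈ allPathsTo k ↔ PathTo k S := by
    simp [allPathsTo]
  have cancel {k l : Fin n} (hk : k < j) (hl : l < j) {S T : Finset (Fin n)}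
      (hS : PathTo k S) (hT : PathTo l T) (h : insert j S = insert j T) : S = T := by
    rw [← Finset.erase_insert (hS.notMem_of_lt hk), h, Finset.erase_insert (hT.notMem_of_lt hl)]
  rw [allPathsTo_eq, Finset.sum_insert, wShock_singleton, Finset.sum_biUnion]
  · congr 1
    refine Finset.sum_congr rfl fun k hk => ?_
    have hkj := Finset.mem_Iio.1 hk
    rw [Finset.sum_image, Finset.mul_sum]
    · exact Finset.sum_congr rfl fun S hS => wShock_insert B Ω i (mem.1 hS) hkj
    · exact fun S hS T hT h => cancel hkj hkj (mem.1 hS) (mem.1 hT) h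
  · intro k hk l hl hkl
    refine Finset.disjoint_left.2 fun U hU hU' => hkl ?_
    obtain ⟨S, hS, rfl⟩ := Finset.mem_image.1 hU
    obtain ⟨T, hT, hTS⟩ := Finset.mem_image.1 hU'
    have hS := mem.1 hS
    have hT := mem.1 hT
    obtain rfl := cancel (by simpa using hl) (by simpa using hk) hT hS hTS
    exact le_antisymm (hT.2 k hS.1) (hS.2 l hT.1)
  · simp only [Finset.mem_biUnion, Finset.mem_Iio, Finset.mem_image, not_exists, not_and]
    rintro k hk S hS h
    have hkS : k ∈ ({j} : Finset (Fin n)) := h ▸ Finset.mem_insert_of_mem (mem.1 hS).1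
    exact hk.ne (Finset.mem_singleton.1 hkS)

/-- The impulse response is the sum of the weights of all paths. -/
theorem inv_mul_apply_eq_sum_wShock (B : Matrix (Fin n) (Fin n) ℝ)
    (Ω : Matrix (Fin n) (Fin m) ℝ) (hB : ∀ j k : Fin n, j ≤ k → B j k = 0)
    (i : Fin m) (j : Fin n) :
    ((1 - B)⁻¹ * Ω) j i = ∑ S ∈ allPathsTo j, wShock B Ω i S := by
  have hdet : (1 - B).det = 1 := by
    rw [Matrix.det_of_isLowerTriangular]
    · simp [hB]
    · intro a b hab
      have hab : a < b := hab
      simp [hB a b hab.le, hab.ne]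
  let F : Matrix (Fin n) (Fin m) ℝ := Matrix.of fun a c => ∑ S ∈ allPathsTo a, wShock B Ω c S
  have hF : (1 - B) * F = Ω := by
    ext a c
    have hsum : ∑ k ∈ Finset.Iio a, B a k * F k c = ∑ k, B a k * F k c :=
      Finset.sum_subset (Finset.subset_univ _) fun k _ hk => by
        rw [hB a k (by simpa using hk), zero_mul]
    have hrec : F a c = Ω a c + ∑ k ∈ Finset.Iio a, B a k * F k c :=
      sum_wShock_allPathsTo B Ω c a
    rw [Matrix.sub_mul, Matrix.one_mul, Matrix.sub_apply, Matrix.mul_apply, hrec, hsum,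
      add_sub_cancel_right]
  have hinv : (1 - B)⁻¹ * Ω = F := by
    rw [← hF, Matrix.nonsing_inv_mul_cancel_left _ _ (by simp [hdet])]
  rw [hinv]
  rfl

/-- After the edge deletion, a path keeps its weight if it avoids `N₂` and passes through every
element of `N₁` before its end, and has weight zero otherwise. -/
theorem wShock_edge_deletion (B Bbar : Matrix (Fin n) (Fin n) ℝ)
    (Ω Ωbar : Matrix (Fin n) (Fin m) ℝ) (i : Fin m) (N₁ N₂ : Finset (Fin n))
    (hBbar : ∀ r s : Fin n, Bbar r s =
      if (∃ k ∈ N₁, k < r ∧ s < k) ∨ (r ∈ N₂ ∧ s < r) then 0 else B r s)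
    (hΩbar : ∀ r : Fin n, Ωbar r i = if (∃ k ∈ N₁, k < r) ∨ r ∈ N₂ then 0 else Ω r i)
    (j : Fin n) (S : Finset (Fin n)) (hS : PathTo j S) :
    wShock Bbar Ωbar i S =
      if (∀ k ∈ N₁, k < j → k ∈ S) ∧ ∀ k ∈ N₂, k ∉ S then wShock B Ω i S else 0 := by
  induction j using WellFoundedLT.induction generalizing S with
  | ind j ih =>
  rcases hS.eq_singleton_or_insert with rfl | ⟨k, hkj, T, hT, rfl⟩
  · rw [wShock_singleton, wShock_singleton, hΩbar, ← ite_not]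
    refine if_congr ?_ rfl rfl
    grind
  · have hcond : ((∀ a ∈ N₁, a < j → a ∈ insert j T) ∧ ∀ a ∈ N₂, a ∉ insert j T) ↔
        ¬((∃ a ∈ N₁, a < j ∧ k < a) ∨ (j ∈ N₂ ∧ k < j)) ∧
          ((∀ a ∈ N₁, a < k → a ∈ T) ∧ ∀ a ∈ N₂, a ∉ T) := by
      have h₁ := hT.1
      have h₂ := hT.2
      grind
    rw [wShock_insert _ _ _ hT hkj, wShock_insert _ _ _ hT hkj, ih k hkj T hT,
      (hBbar j k).trans (ite_not _ _ _).symm, ite_zero_mul_ite_zero]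
    exact (if_congr hcond rfl rfl).symm

/-- correctness of the edge-deletion algorithm: with edges deleted so
that every path must pass through each `x_k`, `k ∈ N₁`, and through no `x_k`,
`k ∈ N₂`, the resulting impulse response `ξ·((I−B̄)⁻¹Ω̄)_{j,i}` equals the
transmission effect (w.r.t. the original `B`, `Ω`) of the corresponding channel. -/
theorem edge_deletion_algorithm_correct (n m : ℕ) (hn : 0 < n) (hm : 0 < m)
    (B Bbar : Matrix (Fin n) (Fin n) ℝ) (Ω Ωbar : Matrix (Fin n) (Fin m) ℝ)
    (hB : ∀ j k : Fin n, j ≤ k → B j k = 0)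
    (i : Fin m) (j : Fin n)
    (N₁ N₂ : Finset (Fin n)) (hdisj : Disjoint N₁ N₂)
    (hN₁ : ∀ k ∈ N₁, k < j) (hN₂ : ∀ k ∈ N₂, k < j)
    (hBbar : ∀ r s : Fin n, Bbar r s =
      if (∃ k ∈ N₁, k < r ∧ s < k) ∨ (r ∈ N₂ ∧ s < r) then 0 else B r s)
    (hΩbar : ∀ (r : Fin n) (c : Fin m), Ωbar r c =
      if c = i ∧ ((∃ k ∈ N₁, k < r) ∨ r ∈ N₂) then 0 else Ω r c)
    (ξ : ℝ) :
    ξ * ((1 - Bbar)⁻¹ * Ωbar) j i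
      = Q ξ (wShock B Ω i)
          ((allPathsTo j).filter (fun S => (∀ k ∈ N₁, k ∈ S) ∧ ∀ k ∈ N₂, k ∉ S)) := by
  have hBbar_lower : ∀ r s : Fin n, r ≤ s → Bbar r s = 0 := fun r s h => by
    rw [hBbar, hB r s h, ite_self]
  have hΩbar_col : ∀ r : Fin n, Ωbar r i =
      if (∃ k ∈ N₁, k < r) ∨ r ∈ N₂ then 0 else Ω r i := fun r => by
    simpa using hΩbar r i
  rw [inv_mul_apply_eq_sum_wShock Bbar Ωbar hBbar_lower, Q, Finset.sum_filter]
  congr 1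
  refine Finset.sum_congr rfl fun S hS => ?_
  rw [wShock_edge_deletion B Bbar Ω Ωbar i N₁ N₂ hBbar hΩbar_col j S
    (by simpa [allPathsTo] using hS)]
  refine if_congr (and_congr_left' ?_) rfl rfl
  exact forall₂_congr fun k hk => by simp [hN₁ k hk]

end TCA
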